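/- Let T ∈ (0, +∞], A, B ∈ (0, +∞) and b ∈ (1, ∞). Let α : [0,T) → ℝ be a continuous non-negative function satisfying α(t) ≤ A + B ∫₀^t (α(s) + α(s)^b) ds for all t ∈ [0,T). Let T₁ ∈ (0,T) and set T₀ = min{ T₁, 1/(3^b · B · (A^{b−1} + (B T₁)^{b−1})) }. Then α(t) ≤ 3A for every t ∈ [0, T₀] with t < T. -/

import Mathlib

/- Nonlinear Grönwall-type lemma with superlinear power `b > 1`. -/

open MeasureTheory Set ENNReal

/-- A continuous function on `[0, t]` that stays strictly below a level as long as its past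
does is strictly below that level at time `t`. -/
theorem lt_of_continuousOn_of_forall_bootstrap {f : ℝ → ℝ} {t M : ℝ} (ht : 0 ≤ t)
    (hf : ContinuousOn f (Icc 0 t))
    (hstep : ∀ s ∈ Icc 0 t, (∀ r ∈ Ico 0 s, f r < M) → f s < M) : f t < M := by
  by_contra! hM
  have hcompact : IsCompact (Icc 0 t ∩ f ⁻¹' Ici M) :=
    isCompact_Icc.of_isClosed_subset
      (hf.preimage_isClosed_of_isClosed isClosed_Icc isClosed_Ici) inter_subset_left
  obtain ⟨s, ⟨hs, hsM⟩, hmin⟩ := hcompact.exists_isLeast ⟨t, ⟨ht, le_rfl⟩, hM⟩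
  refine (hstep s hs fun r hr => ?_).not_ge hsM
  by_contra! hrM
  exact hr.2.not_ge (hmin ⟨⟨hr.1, hr.2.le.trans hs.2⟩, hrM⟩)

/-- On the time interval of the superlinear Grönwall lemma, the integrand bound at level `3A`
closes strictly. -/
theorem superlinear_level_bound_lt {A B b T₁ s : ℝ} (hA : 0 < A) (hB : 0 < B) (hb : 1 < b)
    (hT₁ : 0 < T₁) (hs : 0 ≤ s)
    (hs' : s ≤ min T₁ (1 / (3 ^ b * B * (A ^ (b - 1) + (B * T₁) ^ (b - 1))))) :
    A + B * ((3 * A + (3 * A) ^ b) * s) < 3 * A := by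
  obtain ⟨hs₁, hs₂⟩ := le_min_iff.mp hs'
  have h3 : (0 : ℝ) < 3 ^ b := by positivity
  have hP : 0 < A ^ (b - 1) := by positivity
  have hQ : 0 < (B * T₁) ^ (b - 1) := by positivity
  rw [le_div_iff₀ (by positivity)] at hs₂
  have hmul : ∀ x : ℝ, 0 < x → x ^ b = x * x ^ (b - 1) := fun x hx => by
    rw [Real.rpow_sub_one hx.ne']
    field_simp
  have hsmall : 3 * (B * s) ≤ 1 := by
    by_contra! hlt
    have hs0 : 0 < B * s := by linarith
    have hle : (B * s) ^ (b - 1) ≤ (B * T₁) ^ (b - 1) :=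
      Real.rpow_le_rpow hs0.le (by gcongr) (by linarith)
    have hpow : 1 < (3 * (B * s)) ^ b := Real.one_lt_rpow hlt (by linarith)
    rw [Real.mul_rpow (by norm_num) hs0.le, hmul _ hs0] at hpow
    have h₁ : 3 ^ b * (B * s * (B * s) ^ (b - 1)) ≤ 3 ^ b * (B * s * (B * T₁) ^ (b - 1)) := by
      gcongr
    have h₂ : 0 ≤ 3 ^ b * (B * s) * A ^ (b - 1) := by positivity
    linarith
  have hsuper : 3 ^ b * (B * s) * A ^ (b - 1) < 1 := by
    rcases hs.eq_or_lt with rfl | hs0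
    · simp
    · have : 0 < 3 ^ b * (B * s) * (B * T₁) ^ (b - 1) := by positivity
      linarith
  rw [Real.mul_rpow (by norm_num) hA.le, hmul A hA]
  have h₁ := mul_le_mul_of_nonneg_left hsmall hA.le
  have h₂ := mul_lt_mul_of_pos_left hsuper hA
  linarith

/-- **Grönwall lemma, superlinear case.** Let `α` be a continuous non-negative function
on `[0,T)` (where `T ∈ (0, +∞]`) satisfying `α(t) ≤ A + B ∫₀ᵗ (α(s) + α(s)^b) ds` with
`A, B > 0` and `b > 1`. Let `T₁ ∈ (0,T)` and
`T₀ = min{T₁, 1/(3^b B (A^{b-1} + (B T₁)^{b-1}))}`. Then `α(t) ≤ 3A` on `[0, T₀]`. -/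
theorem gronwall_superlinear
    (T : ℝ≥0∞) (hT : 0 < T) (A B b : ℝ) (hA : 0 < A) (hB : 0 < B) (hb : 1 < b)
    (α : ℝ → ℝ)
    (hcont : ContinuousOn α {t : ℝ | 0 ≤ t ∧ ENNReal.ofReal t < T})
    (hnonneg : ∀ t : ℝ, 0 ≤ t → ENNReal.ofReal t < T → 0 ≤ α t)
    (hineq : ∀ t : ℝ, 0 ≤ t → ENNReal.ofReal t < T →
      α t ≤ A + B * ∫ s in Icc (0:ℝ) t, (α s + α s ^ b))
    (T₁ : ℝ) (hT₁pos : 0 < T₁) (hT₁lt : ENNReal.ofReal T₁ < T) :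
    ∀ t : ℝ, 0 ≤ t →
      t ≤ min T₁ (1 / (3 ^ b * B * (A ^ (b - 1) + (B * T₁) ^ (b - 1)))) →
      ENNReal.ofReal t < T →
      α t ≤ 3 * A := by
  intro t ht htT₀ htT
  have hdom : ∀ s ≤ t, ENNReal.ofReal s < T := fun s hs =>
    (ENNReal.ofReal_le_ofReal hs).trans_lt htT
  refine (lt_of_continuousOn_of_forall_bootstrap ht
    (hcont.mono fun s hs => ⟨hs.1, hdom s hs.2⟩) fun s hs hpast => ?_).le
  have hbound : ∫ r in Icc (0 : ℝ) s, (α r + α r ^ b) ≤ (3 * A + (3 * A) ^ b) * s := by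
    rw [integral_Icc_eq_integral_Ico]
    have hnorm : ∀ r ∈ Ico (0 : ℝ) s, ‖α r + α r ^ b‖ ≤ 3 * A + (3 * A) ^ b := fun r hr => by
      have h0 := hnonneg r hr.1 (hdom r (hr.2.le.trans hs.2))
      have hle := (hpast r hr).le
      rw [Real.norm_of_nonneg (by positivity)]
      gcongr
    have h := norm_setIntegral_le_of_norm_le_const (μ := volume) (by simp) hnorm
    rw [Real.volume_real_Ico_of_le hs.1, sub_zero] at h
    exact (Real.le_norm_self _).trans h
  calc α s ≤ A + B * ∫ r in Icc (0 : ℝ) s, (α r + α r ^ b) := hineq s hs.1 (hdom s hs.2)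
    _ ≤ A + B * ((3 * A + (3 * A) ^ b) * s) := by gcongr
    _ < 3 * A := superlinear_level_bound_lt hA hB hb hT₁pos hs.1 (hs.2.trans htT₀)
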